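/- Linear convergence rate (case s = 2, q = ∞): let γ† ∈ A be C² with c₂ := 2·sup_{t∈S¹}|γ†''(t)| > 0, let δ > 0, let u^δ ∈ L²(S¹×[0,∞)) satisfy ‖u^δ − F(γ†)‖_{L²} ≤ δ, let 0 < α ≤ 1/(2c₂), and let γ_α^δ ∈ A satisfy T_α(γ_α^δ; u^δ) ≤ T_α(γ; u^δ) for every γ ∈ A. Then ∫_{S¹} (γ_α^δ'(t) − γ†'(t))² dμ(t) ≤ δ²/α + 2c₂δ²; in particular ‖γ_α^δ' − γ†'‖_{L²(S¹)} ≤ √(1/α + 2c₂) · δ. -/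

import Mathlib

open MeasureTheory Real Set Filter Topology

noncomputable section

instance : Fact (0 < 2 * π) := ⟨by positivity⟩

/-- The circle `ℝ / 2πℤ`. -/
abbrev S1 : Type := AddCircle (2 * π)

/-- The Haar measure of total mass `2π` on the circle. -/
abbrev μ : Measure S1 := volume

/-- The product of `μ` with Lebesgue measure restricted to `[0, ∞)`,
modelling the measure on `S¹ × [0, ∞)`. -/
abbrev ν : Measure (S1 × ℝ) := μ.prod (volume.restrict (Ici (0:ℝ)))

/-- The characteristic function of the hypograph of `γ`:
`F γ (t, x) = 1` if `x ≤ γ t` and `0` otherwise. -/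
def F (γ : S1 → ℝ) : S1 × ℝ → ℝ := fun p => if p.2 ≤ γ p.1 then 1 else 0

/-- `γ : S¹ → ℝ` is `C¹` with derivative `dγ` if the corresponding `2π`-periodic function
on `ℝ` is everywhere differentiable with derivative the periodic function corresponding
to `dγ`, and `dγ` is continuous. -/
def IsC1 (γ dγ : S1 → ℝ) : Prop :=
  Continuous dγ ∧ ∀ t : ℝ, HasDerivAt (fun x : ℝ => γ (x : S1)) (dγ (t : S1)) t

/-- The Tikhonov functional
`T_α(γ; u) = ‖F γ - u‖²_{L²(S¹×[0,∞))} + α ∫ γ'(t)² dμ(t)`,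
where `dγ` denotes the derivative `γ'`. -/
def T (α : ℝ) (γ dγ : S1 → ℝ) (u : S1 × ℝ → ℝ) : ℝ :=
  (eLpNorm (fun p => F γ p - u p) 2 ν).toReal ^ 2 + α * ∫ t, dγ t ^ 2 ∂μ

theorem IsC1.continuous {γ dγ : S1 → ℝ} (h : IsC1 γ dγ) : Continuous γ := by
  have hq : IsQuotientMap ((↑) : ℝ → S1) := isQuotientMap_quotient_mk'
  rw [hq.continuous_iff]
  exact continuous_iff_continuousAt.2 fun t => (h.2 t).continuousAt

theorem IsC1.sub {f df g dg : S1 → ℝ} (hf : IsC1 f df) (hg : IsC1 g dg) :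
    IsC1 (fun t => f t - g t) (fun t => df t - dg t) :=
  ⟨hf.1.sub hg.1, fun t => (hf.2 t).sub (hg.2 t)⟩

theorem IsC1.mul {f df g dg : S1 → ℝ} (hf : IsC1 f df) (hg : IsC1 g dg) :
    IsC1 (fun t => f t * g t) (fun t => df t * g t + f t * dg t) :=
  ⟨(hf.1.mul hg.continuous).add (hf.continuous.mul hg.1), fun t => (hf.2 t).mul (hg.2 t)⟩

theorem integrable_of_continuous {f : S1 → ℝ} (hf : Continuous f) : Integrable f μ :=
  hf.integrable_of_hasCompactSupport (HasCompactSupport.of_compactSpace f)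

/-- The derivative of a `C¹` function on the circle has integral zero. -/
theorem IsC1.integral_deriv_eq_zero {γ dγ : S1 → ℝ} (h : IsC1 γ dγ) : ∫ t, dγ t ∂μ = 0 := by
  rw [← AddCircle.intervalIntegral_preimage (2 * π) 0 dγ,
    intervalIntegral.integral_eq_sub_of_hasDerivAt (fun x _ => h.2 x)
      ((h.1.comp (AddCircle.continuous_mk' _)).intervalIntegrable _ _), zero_add,
    AddCircle.coe_period, AddCircle.coe_zero, sub_self]

/-- Integration by parts on the circle. -/
theorem IsC1.integral_mul_deriv {f df g dg : S1 → ℝ} (hf : IsC1 f df) (hg : IsC1 g dg) :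
    ∫ t, f t * dg t ∂μ = -∫ t, df t * g t ∂μ := by
  have h := (hf.mul hg).integral_deriv_eq_zero
  have hadd := integral_add (integrable_of_continuous (hf.1.mul hg.continuous))
    (integrable_of_continuous (hf.continuous.mul hg.1))
  simp only [Pi.mul_apply] at hadd
  linarith

theorem measurable_F {γ : S1 → ℝ} (hγ : Continuous γ) : Measurable (F γ) :=
  Measurable.ite (measurableSet_le measurable_snd (hγ.measurable.comp measurable_fst))
    measurable_const measurable_const

theorem eLpNorm_two_sq {X : Type*} [MeasurableSpace X] (m : Measure X) (f : X → ℝ) :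
    eLpNorm f 2 m ^ 2 = ∫⁻ x, ‖f x‖ₑ ^ 2 ∂m := by
  have h := eLpNorm_nnreal_pow_eq_lintegral (μ := m) (f := f) (p := 2) two_ne_zero
  simpa using h

theorem lintegral_indicator_le_sub_sq {a b : ℝ} (ha : 0 ≤ a) (hb : 0 ≤ b) :
    ∫⁻ x in Ici (0 : ℝ), ‖(if x ≤ a then (1 : ℝ) else 0) - (if x ≤ b then 1 else 0)‖ₑ ^ 2
      = ENNReal.ofReal |a - b| := by
  have h : ∀ x : ℝ, ‖(if x ≤ a then (1 : ℝ) else 0) - (if x ≤ b then 1 else 0)‖ₑ ^ 2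
      = (uIoc a b).indicator (fun _ => (1 : ENNReal)) x := by
    intro x
    by_cases h1 : x ≤ a <;> by_cases h2 : x ≤ b <;>
      simp [h1, h2, indicator, mem_uIoc]
  simp_rw [h]
  rw [lintegral_indicator measurableSet_uIoc, setLIntegral_one,
    Measure.restrict_apply measurableSet_uIoc, inter_eq_left.2, Real.volume_uIoc, abs_sub_comm]
  intro x hx
  rw [mem_uIoc] at hx
  rw [mem_Ici]
  rcases hx with hx | hx <;> linarith [hx.1]

/-- The squared `L²` distance of two hypographs is the `L¹` distance of the functions. -/
theorem eLpNorm_F_sub_sq {f g : S1 → ℝ} (hf : Continuous f) (hg : Continuous g)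
    (hf0 : ∀ t, 0 ≤ f t) (hg0 : ∀ t, 0 ≤ g t) :
    eLpNorm (fun p => F f p - F g p) 2 ν ^ 2 = ENNReal.ofReal (∫ t, |f t - g t| ∂μ) := by
  have hmeas : Measurable fun p => ‖F f p - F g p‖ₑ ^ 2 :=
    ((measurable_F hf).sub (measurable_F hg)).enorm.pow_const 2
  have hint : Integrable (fun t => |f t - g t|) μ := integrable_of_continuous (hf.sub hg).abs
  rw [eLpNorm_two_sq, lintegral_prod _ hmeas.aemeasurable,
    ofReal_integral_eq_lintegral_ofReal hint (ae_of_all _ fun t => abs_nonneg _)]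
  exact lintegral_congr fun t => lintegral_indicator_le_sub_sq (hf0 t) (hg0 t)

theorem eLpNorm_two_sub_triangle {X : Type*} [MeasurableSpace X] {m : Measure X} {f g h : X → ℝ}
    (hf : AEStronglyMeasurable f m) (hg : AEStronglyMeasurable g m)
    (hh : AEStronglyMeasurable h m) :
    eLpNorm (fun x => f x - h x) 2 m
      ≤ eLpNorm (fun x => f x - g x) 2 m + eLpNorm (fun x => g x - h x) 2 m := by
  have hadd := eLpNorm_add_le (hf.sub hg) (hg.sub hh) one_le_two
  rwa [sub_add_sub_cancel] at hadd

/-- Linear convergence rate in the case `s = 2`, `q = ∞`: if `γ†` is a nonnegative `C²`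
function with `c₂ = 2 sup |γ†''| > 0`, `‖u^δ - F γ†‖_{L²} ≤ δ`, `0 < α ≤ 1/(2c₂)`, and
`γ_α^δ` minimizes the Tikhonov functional `T_α(·; u^δ)` over the nonnegative `C¹`
functions, then `∫ (γ_α^δ' - γ†')² dμ ≤ δ²/α + 2c₂δ²`; in particular
`‖γ_α^δ' - γ†'‖_{L²} ≤ √(1/α + 2c₂) δ`. -/
theorem linear_convergence_rate (γdag d1 d2 : S1 → ℝ)
    (h1 : IsC1 γdag d1) (h2 : IsC1 d1 d2) (hdag0 : ∀ t, 0 ≤ γdag t)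
    (c₂ : ℝ) (hc₂def : c₂ = 2 * ⨆ t : S1, |d2 t|) (hc₂ : 0 < c₂)
    (δ : ℝ) (hδ : 0 < δ)
    (u : S1 × ℝ → ℝ) (hu : MemLp u 2 ν)
    (hnoise : eLpNorm (fun p => u p - F γdag p) 2 ν ≤ ENNReal.ofReal δ)
    (α : ℝ) (hα : 0 < α) (hα2 : α ≤ 1 / (2 * c₂))
    (γm dm : S1 → ℝ) (hγm : IsC1 γm dm) (hγm0 : ∀ t, 0 ≤ γm t)
    (hmin : ∀ γ dγ : S1 → ℝ, IsC1 γ dγ → (∀ t, 0 ≤ γ t) → T α γm dm u ≤ T α γ dγ u) :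
    ∫ t, (dm t - d1 t) ^ 2 ∂μ ≤ δ ^ 2 / α + 2 * c₂ * δ ^ 2
    ∧ Real.sqrt (∫ t, (dm t - d1 t) ^ 2 ∂μ) ≤ Real.sqrt (1 / α + 2 * c₂) * δ := by
  have hcm := hγm.continuous
  have hcd := h1.continuous
  have hFm := (measurable_F hcm).aestronglyMeasurable (μ := ν)
  have hFd := (measurable_F hcd).aestronglyMeasurable (μ := ν)
  have hI0 : 0 ≤ ∫ t, |γm t - γdag t| ∂μ := integral_nonneg fun t => abs_nonneg _
  -- the `L²` distances between `F γm`, `F γdag` and `u`, with the triangle inequality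
  have hDsq := eLpNorm_F_sub_sq hcm hcd hγm0 hdag0
  set D := eLpNorm (fun p => F γm p - F γdag p) 2 ν
  set A := eLpNorm (fun p => F γm p - u p) 2 ν with hA
  set B := eLpNorm (fun p => u p - F γdag p) 2 ν
  have hBtop : B ≠ ⊤ := ne_top_of_le_ne_top ENNReal.ofReal_ne_top hnoise
  have hDtop : D ≠ ⊤ := by
    intro h
    simp [h] at hDsq
  have hBswap : eLpNorm (fun p => F γdag p - u p) 2 ν = B := eLpNorm_sub_comm (F γdag) u 2 ν
  have hAtop : A ≠ ⊤ := by
    refine ne_top_of_le_ne_top (ENNReal.add_ne_top.2 ⟨hDtop, hBtop⟩) ?_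
    rw [← hBswap]
    exact eLpNorm_two_sub_triangle hFm hFd hu.1
  have hDAB : D ≤ A + B := eLpNorm_two_sub_triangle hFm hu.1 hFd
  have hDabs : ∫ t, |γm t - γdag t| ∂μ ≤ (A.toReal + B.toReal) ^ 2 := by
    have h := congrArg ENNReal.toReal hDsq
    rw [ENNReal.toReal_pow, ENNReal.toReal_ofReal hI0] at h
    rw [← h, ← ENNReal.toReal_add hAtop hBtop]
    gcongr
    exact ENNReal.add_ne_top.2 ⟨hAtop, hBtop⟩
  have hBδ : B.toReal ≤ δ := ENNReal.toReal_le_of_le_ofReal hδ.le hnoise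
  have hT := hmin γdag d1 h1 hdag0
  simp only [T, hBswap, ← hA] at hT
  -- the regularization terms, using integration by parts
  have hexpand : ∫ t, (dm t - d1 t) ^ 2 ∂μ
      = ∫ t, dm t ^ 2 ∂μ - ∫ t, d1 t ^ 2 ∂μ + 2 * ∫ t, d2 t * (γm t - γdag t) ∂μ := by
    have hparts := h2.integral_mul_deriv (hγm.sub h1)
    have hint : ∫ t, (dm t - d1 t) ^ 2 ∂μ
        = ∫ t, dm t ^ 2 ∂μ - ∫ t, d1 t ^ 2 ∂μ - 2 * ∫ t, d1 t * (dm t - d1 t) ∂μ := by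
      have i1 : Integrable (fun t => dm t ^ 2) μ := integrable_of_continuous (hγm.1.pow 2)
      have i2 : Integrable (fun t => d1 t ^ 2) μ := integrable_of_continuous (h1.1.pow 2)
      have i12 : Integrable (fun t => dm t ^ 2 - d1 t ^ 2) μ := i1.sub i2
      have i3 : Integrable (fun t => d1 t * (dm t - d1 t)) μ :=
        integrable_of_continuous (h1.1.mul (hγm.1.sub h1.1))
      rw [← integral_const_mul, ← integral_sub i1 i2, ← integral_sub i12 (i3.const_mul 2)]
      exact integral_congr_ae (ae_of_all _ fun t => by ring)
    rw [hint, hparts]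
    ring
  have hsup : ∀ t, 2 * |d2 t| ≤ c₂ := by
    intro t
    rw [hc₂def]
    gcongr
    exact le_ciSup (isCompact_range h2.1.abs).bddAbove t
  have hcross : 2 * ∫ t, d2 t * (γm t - γdag t) ∂μ ≤ c₂ * ∫ t, |γm t - γdag t| ∂μ := by
    rw [← integral_const_mul, ← integral_const_mul]
    refine integral_mono
      (integrable_of_continuous (continuous_const.mul (h2.1.mul (hcm.sub hcd))))
      (integrable_of_continuous (continuous_const.mul (hcm.sub hcd).abs)) fun t => ?_
    calc 2 * (d2 t * (γm t - γdag t)) ≤ 2 * |d2 t * (γm t - γdag t)| := by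
          gcongr
          exact le_abs_self _
      _ = 2 * |d2 t| * |γm t - γdag t| := by rw [abs_mul, mul_assoc]
      _ ≤ c₂ * |γm t - γdag t| := by
          gcongr
          exact hsup t
  have hmain : ∫ t, (dm t - d1 t) ^ 2 ∂μ ≤ δ ^ 2 / α + 2 * c₂ * δ ^ 2 := by
    have hαc : 2 * c₂ ≤ 1 / α := by
      rw [le_div_iff₀ (by positivity)] at hα2 ⊢
      linarith
    have hB0 : 0 ≤ B.toReal := ENNReal.toReal_nonneg
    have hreg : ∫ t, dm t ^ 2 ∂μ - ∫ t, d1 t ^ 2 ∂μ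
        ≤ 1 / α * (B.toReal ^ 2 - A.toReal ^ 2) := by
      rw [one_div_mul_eq_div, le_div_iff₀ hα]
      linarith
    calc ∫ t, (dm t - d1 t) ^ 2 ∂μ
        ≤ 1 / α * (B.toReal ^ 2 - A.toReal ^ 2) + c₂ * (A.toReal + B.toReal) ^ 2 := by
          rw [hexpand]
          exact add_le_add hreg (hcross.trans (by gcongr))
      _ ≤ 1 / α * (B.toReal ^ 2 - A.toReal ^ 2) + c₂ * (2 * (A.toReal ^ 2 + B.toReal ^ 2)) := by
          gcongr
          exact add_sq_le
      _ ≤ (1 / α + 2 * c₂) * B.toReal ^ 2 := by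
          linarith [mul_le_mul_of_nonneg_right hαc (sq_nonneg A.toReal)]
      _ ≤ (1 / α + 2 * c₂) * δ ^ 2 := by gcongr
      _ = δ ^ 2 / α + 2 * c₂ * δ ^ 2 := by ring
  refine ⟨hmain, ?_⟩
  rw [Real.sqrt_le_left (by positivity), mul_pow, Real.sq_sqrt (by positivity)]
  exact hmain.trans_eq (by ring)
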